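/- Integral coercivity of the spin-diffusion form: Let (X, μ) be a measure space and let D_*, β, β' ∈ ℝ with D_* > 0, 0 < β < 1, 0 < β' < 1. Let D₀ : X → ℝ, m : X → ℝ³, G : X → Matrix (Fin 3) (Fin 3) ℝ, and s : X → ℝ³ be measurable with D₀ x ≥ D_* for μ-a.e. x and ‖m x‖ = 1 for μ-a.e. x. Assume the functions x ↦ D₀ x · ‖G x‖_F², x ↦ D₀ x · ‖s x‖², and x ↦ ‖G x‖_F² + ‖s x‖² are integrable. Then ∫ D₀ x · ( ‖G x‖_F² − β β' · Σ_{j,k} (m x)_j ((G x)ᵀ (m x))_k (G x)_{jk} + ‖s x‖² + ⟪(s x) ×₃ (m x), s x⟫ ) dμ ≥ (1 − β β') D_* ∫ ( ‖G x‖_F² + ‖s x‖² ) dμ. -/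

import Mathlib

open scoped RealInnerProductSpace
open MeasureTheory

/-- The cross product on `ℝ³ = EuclideanSpace ℝ (Fin 3)`. -/
noncomputable def cross3 (a b : EuclideanSpace ℝ (Fin 3)) : EuclideanSpace ℝ (Fin 3) :=
  (EuclideanSpace.equiv (Fin 3) ℝ).symm
    (crossProduct ((EuclideanSpace.equiv (Fin 3) ℝ) a) ((EuclideanSpace.equiv (Fin 3) ℝ) b))

/-- Expanding `⟪m ⊗ Gᵀm, G⟫` gives `‖Gᵀm‖²`. -/
lemma sum_mul_transpose_mulVec_mul (G : Matrix (Fin 3) (Fin 3) ℝ) (v : Fin 3 → ℝ) :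
    ∑ j : Fin 3, ∑ k : Fin 3, v j * G.transpose.mulVec v k * G j k
      = ∑ k : Fin 3, (∑ j : Fin 3, G j k * v j) ^ 2 := by
  rw [Finset.sum_comm]
  refine Finset.sum_congr rfl fun k _ => ?_
  simp only [Matrix.mulVec, dotProduct, Matrix.transpose_apply]
  rw [sq, Finset.mul_sum]
  exact Finset.sum_congr rfl fun j _ => by ring

/-- `‖Gᵀm‖² ≤ ‖G‖_F²` for a unit vector `m`. -/
lemma sum_sq_transpose_mulVec_le (G : Matrix (Fin 3) (Fin 3) ℝ)
    (m : EuclideanSpace ℝ (Fin 3)) (hm : ‖m‖ = 1) :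
    ∑ k : Fin 3, (∑ j : Fin 3, G j k * m j) ^ 2 ≤ ∑ j : Fin 3, ∑ k : Fin 3, G j k ^ 2 := by
  have hm' : ∑ j : Fin 3, m j ^ 2 = 1 := by
    rw [← EuclideanSpace.real_norm_sq_eq, hm, one_pow]
  rw [Finset.sum_comm]
  refine Finset.sum_le_sum fun k _ => ?_
  simpa [hm'] using Finset.sum_mul_sq_le_sq_mul_sq Finset.univ (fun j => G j k) (fun j => m j)

/-- The cross product is orthogonal to its left factor. -/
lemma inner_cross3_left (a b : EuclideanSpace ℝ (Fin 3)) : ⟪cross3 a b, a⟫ = 0 := by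
  simp [cross3, PiLp.inner_apply, Fin.sum_univ_three, cross_apply]
  ring

/-- Integral coercivity of the spin-diffusion bilinear form. -/
theorem integral_coercivity_spin_diffusion
    {X : Type*} [MeasurableSpace X] (μ : Measure X)
    (Dstar β β' : ℝ) (hDstar : 0 < Dstar)
    (hβ0 : 0 < β) (hβ1 : β < 1) (hβ'0 : 0 < β') (hβ'1 : β' < 1)
    (D0 : X → ℝ) (m : X → EuclideanSpace ℝ (Fin 3))
    (G : X → Matrix (Fin 3) (Fin 3) ℝ) (s : X → EuclideanSpace ℝ (Fin 3))
    (hD0meas : Measurable D0) (hmmeas : Measurable m) (hGmeas : ∀ j k : Fin 3, Measurable fun x => G x j k)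
    (hsmeas : Measurable s)
    (hD0 : ∀ᵐ x ∂μ, Dstar ≤ D0 x) (hm : ∀ᵐ x ∂μ, ‖m x‖ = 1)
    (hint1 : Integrable (fun x => D0 x * ∑ j : Fin 3, ∑ k : Fin 3, G x j k ^ 2) μ)
    (hint2 : Integrable (fun x => D0 x * ‖s x‖ ^ 2) μ)
    (hint3 : Integrable (fun x => (∑ j : Fin 3, ∑ k : Fin 3, G x j k ^ 2) + ‖s x‖ ^ 2) μ) :
    (∫ x, D0 x * ((∑ j : Fin 3, ∑ k : Fin 3, G x j k ^ 2)
        - β * β' * (∑ j : Fin 3, ∑ k : Fin 3,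
            m x j * (G x).transpose.mulVec (fun i => m x i) k * G x j k)
        + ‖s x‖ ^ 2 + ⟪cross3 (s x) (m x), s x⟫) ∂μ)
      ≥ (1 - β * β') * Dstar * ∫ x, ((∑ j : Fin 3, ∑ k : Fin 3, G x j k ^ 2) + ‖s x‖ ^ 2) ∂μ := by
  simp only [inner_cross3_left, add_zero]
  have hT (x : X) := sum_mul_transpose_mulVec_mul (G x) (fun i => m x i)
  simp only [hT]
  have hββ' : β * β' < 1 := by nlinarith
  have hββ'0 : 0 < β * β' := mul_pos hβ0 hβ'0
  have hmj (j : Fin 3) : Measurable fun x => m x j := by fun_prop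
  have hintT : Integrable
      (fun x => D0 x * ∑ k : Fin 3, (∑ j : Fin 3, G x j k * m x j) ^ 2) μ := by
    refine hint1.mono (by fun_prop) ?_
    filter_upwards [hm] with x hmx
    rw [norm_mul, norm_mul]
    gcongr
    rw [Real.norm_of_nonneg (by positivity), Real.norm_of_nonneg (by positivity)]
    exact sum_sq_transpose_mulVec_le (G x) (m x) hmx
  rw [ge_iff_le, ← integral_const_mul]
  refine integral_mono_ae (hint3.const_mul _) ?_ ?_
  · refine ((hint1.sub (hintT.const_mul (β * β'))).add hint2).congr (.of_forall fun x => ?_)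
    simp only [Pi.add_apply, Pi.sub_apply]
    ring
  · filter_upwards [hD0, hm] with x hDx hmx
    have hle := sum_sq_transpose_mulVec_le (G x) (m x) hmx
    have hG : 0 ≤ ∑ j : Fin 3, ∑ k : Fin 3, G x j k ^ 2 := by positivity
    generalize ∑ k : Fin 3, (∑ j : Fin 3, G x j k * m x j) ^ 2 = T at hle ⊢
    generalize ∑ j : Fin 3, ∑ k : Fin 3, G x j k ^ 2 = F at hle hG ⊢
    have hs : 0 ≤ ‖s x‖ ^ 2 := by positivity
    have hD : 0 ≤ D0 x := hDstar.le.trans hDx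
    calc (1 - β * β') * Dstar * (F + ‖s x‖ ^ 2)
        = Dstar * ((1 - β * β') * (F + ‖s x‖ ^ 2)) := by ring
      _ ≤ D0 x * ((1 - β * β') * (F + ‖s x‖ ^ 2)) :=
          mul_le_mul_of_nonneg_right hDx (mul_nonneg (by linarith) (by linarith))
      _ ≤ D0 x * (F - β * β' * T + ‖s x‖ ^ 2) :=
          mul_le_mul_of_nonneg_left (by nlinarith) hD
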